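/- Let τ > 0 and let q*_τ be the unique bounded fixed point of the soft Bellman optimality operator B*_τ. For every policy π with sup_{x,a} ∫ KL(π_{x′} ‖ π̄_{x′}) dP_{x,a}(x′) < ∞ and every x ∈ 𝒳: ∫ q^π_τ(x,a) dπₓ(a) − τ · KL(πₓ ‖ π̄ₓ) ≤ (V_τ q*_τ)(x), where q^π_τ is the unique bounded fixed point of B^π_τ. Moreover, for the Boltzmann–Gibbs policy π* of q*_τ (π*ₓ has density exp((q*_τ(x,·) − (V_τ q*_τ)(x))/τ) with respect to π̄ₓ), equality holds: ∫ q^{π*}_τ(x,a) dπ*ₓ(a) − τ · KL(π*ₓ ‖ π̄ₓ) = (V_τ q*_τ)(x). Hence the Boltzmann–Gibbs policy of q*_τ is the optimal policy of the τ-entropy-regularized problem. -/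

import Mathlib

open MeasureTheory ProbabilityTheory ENNReal

/-- Bounded measurable real-valued functions. -/
def BoundedMeasurable {Ω : Type*} [MeasurableSpace Ω] (q : Ω → ℝ) : Prop :=
  Measurable q ∧ ∃ C : ℝ, ∀ p, |q p| ≤ C

open Classical in
/-- Kullback–Leibler divergence. -/
noncomputable def KL {Ω : Type*} [MeasurableSpace Ω] (μ ν : Measure Ω) : ℝ≥0∞ :=
  if μ ≪ ν ∧ Integrable (llr μ ν) μ then ENNReal.ofReal (∫ x, llr μ ν x ∂μ) else ⊤

/-- The soft value `(V_τ q)(x) = τ log ∫ exp(q(x,a)/τ) dπ̄ₓ(a)`. -/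
noncomputable def softV {X A : Type*} [MeasurableSpace X] [MeasurableSpace A]
    (τ : ℝ) (piRef : Kernel X A) (q : X × A → ℝ) (x : X) : ℝ :=
  τ * Real.log (∫ a, Real.exp (q (x, a) / τ) ∂(piRef x))

/-- The soft Bellman optimality operator. -/
noncomputable def softBellmanOpt {X A : Type*} [MeasurableSpace X] [MeasurableSpace A]
    (τ γ : ℝ) (r : X × A → ℝ) (P : Kernel (X × A) X) (piRef : Kernel X A)
    (q : X × A → ℝ) : X × A → ℝ :=
  fun p => r p + γ * ∫ x', softV τ piRef q x' ∂(P p)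

/-- The soft Bellman policy-evaluation operator. -/
noncomputable def softBellmanEval {X A : Type*} [MeasurableSpace X] [MeasurableSpace A]
    (τ γ : ℝ) (r : X × A → ℝ) (P : Kernel (X × A) X) (piRef : Kernel X A)
    (pol : Kernel X A) (q : X × A → ℝ) : X × A → ℝ :=
  fun p => r p + γ *
    ∫ x', ((∫ a', q (x', a') ∂(pol x')) - τ * (KL (pol x') (piRef x')).toReal) ∂(P p)

open InformationTheory Filter Topology

section KullbackLeibler

variable {Ω : Type*} [MeasurableSpace Ω]

theorem KL_eq_klDiv (μ ν : Measure Ω) [IsProbabilityMeasure μ] [IsProbabilityMeasure ν] :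
    KL μ ν = klDiv μ ν := by
  simp [KL, klDiv_def]

/-- The Donsker–Varadhan inequality. -/
theorem integral_sub_KL_le_log_integral_exp {μ ν : Measure Ω} [IsProbabilityMeasure μ]
    [IsProbabilityMeasure ν] {f : Ω → ℝ} (hfμ : Integrable f μ)
    (hfν : Integrable (fun a => Real.exp (f a)) ν) (hKL : KL μ ν ≠ ⊤) :
    ∫ a, f a ∂μ - (KL μ ν).toReal ≤ Real.log (∫ a, Real.exp (f a) ∂ν) := by
  rw [KL_eq_klDiv] at hKL ⊢
  obtain ⟨hac, hint⟩ := klDiv_ne_top_iff.mp hKL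
  have := isProbabilityMeasure_tilted hfν
  have hac' : μ ≪ ν.tilted f := hac.trans (absolutelyContinuous_tilted hfν)
  have h0 : 0 ≤ ∫ a, llr μ (ν.tilted f) a ∂μ := by
    rw [← toReal_klDiv_of_measure_eq hac' (by simp)]
    exact ENNReal.toReal_nonneg
  rw [toReal_klDiv_of_measure_eq hac (by simp)]
  linarith [integral_llr_tilted_right hac hfμ hfν hint]

theorem KL_tilted_ne_top {ν : Measure Ω} [IsProbabilityMeasure ν] {f : Ω → ℝ}
    (hfμ : Integrable f (ν.tilted f)) (hfν : Integrable (fun a => Real.exp (f a)) ν) :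
    KL (ν.tilted f) ν ≠ ⊤ := by
  have := isProbabilityMeasure_tilted hfν
  rw [KL_eq_klDiv]
  refine klDiv_ne_top (tilted_absolutelyContinuous ν f) ?_
  refine (hfμ.sub (integrable_const (Real.log (∫ a, Real.exp (f a) ∂ν)))).congr ?_
  exact ((tilted_absolutelyContinuous ν f).ae_eq (log_rnDeriv_tilted_left_self hfν)).symm

/-- The exponentially tilted measure attains equality in the Donsker–Varadhan inequality. -/
theorem integral_sub_KL_tilted {ν : Measure Ω} [IsProbabilityMeasure ν] {f : Ω → ℝ}
    (hfμ : Integrable f (ν.tilted f)) (hfν : Integrable (fun a => Real.exp (f a)) ν) :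
    ∫ a, f a ∂(ν.tilted f) - (KL (ν.tilted f) ν).toReal
      = Real.log (∫ a, Real.exp (f a) ∂ν) := by
  have := isProbabilityMeasure_tilted hfν
  have hllr := (tilted_absolutelyContinuous ν f).ae_eq (log_rnDeriv_tilted_left_self hfν)
  rw [KL_eq_klDiv, toReal_klDiv_of_measure_eq (tilted_absolutelyContinuous ν f) (by simp),
    llr_def, integral_congr_ae hllr, integral_sub hfμ (integrable_const _)]
  simp

open Classical in
theorem measurable_KL_kernel {X A : Type*} [MeasurableSpace X] [MeasurableSpace A]
    [MeasurableSpace.CountableOrCountablyGenerated X A]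
    (κ η : Kernel X A) [IsMarkovKernel κ] [IsMarkovKernel η] :
    Measurable fun x => KL (κ x) (η x) := by
  have h : (fun x => KL (κ x) (η x)) = fun x => if κ x ≪ η x then
      ∫⁻ a, ENNReal.ofReal (klFun (κ.rnDeriv η x a).toReal) ∂(η x) else ⊤ := by
    funext x
    rw [KL_eq_klDiv, klDiv_eq_lintegral_klFun]
    congr 1
    refine lintegral_congr_ae ?_
    filter_upwards [Kernel.rnDeriv_eq_rnDeriv_measure (κ := κ) (η := η) (a := x)] with a ha
    rw [ha]
  rw [h]
  refine Measurable.ite (Kernel.measurableSet_absolutelyContinuous κ η) ?_ measurable_const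
  refine Measurable.lintegral_kernel_prod_right' (κ := η)
    (f := fun p : X × A => ENNReal.ofReal (klFun (κ.rnDeriv η p.1 p.2).toReal)) ?_
  exact (measurable_klFun.comp (Kernel.measurable_rnDeriv κ η).ennreal_toReal).ennreal_ofReal

end KullbackLeibler

theorem nonpos_of_forall_le_imp_le_mul {ι : Type*} {γ : ℝ} (hγ0 : 0 ≤ γ) (hγ1 : γ < 1)
    {f : ι → ℝ} (hbdd : ∃ C, ∀ i, f i ≤ C)
    (hstep : ∀ M, (∀ i, f i ≤ M) → ∀ i, f i ≤ γ * M) (i : ι) : f i ≤ 0 := by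
  obtain ⟨C, hC⟩ := hbdd
  have h : ∀ (n : ℕ) (i : ι), f i ≤ γ ^ n * C := by
    intro n
    induction n with
    | zero => simpa using hC
    | succ n ih => simpa [pow_succ', mul_assoc] using hstep _ ih
  have hlim : Tendsto (fun n : ℕ => γ ^ n * C) atTop (𝓝 0) := by
    simpa using (tendsto_pow_atTop_nhds_zero_of_lt_one hγ0 hγ1).mul_const C
  exact ge_of_tendsto' hlim fun n => h n i

section BoundedMeasurable

variable {X A : Type*} [MeasurableSpace X] [MeasurableSpace A]

theorem BoundedMeasurable.integrable {Ω : Type*} [MeasurableSpace Ω] {q : Ω → ℝ}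
    (hq : BoundedMeasurable q) (μ : Measure Ω) [IsFiniteMeasure μ] : Integrable q μ := by
  obtain ⟨hm, C, hC⟩ := hq
  exact Integrable.of_bound hm.aestronglyMeasurable C (ae_of_all _ hC)

theorem BoundedMeasurable.sub {Ω : Type*} [MeasurableSpace Ω] {f g : Ω → ℝ}
    (hf : BoundedMeasurable f) (hg : BoundedMeasurable g) :
    BoundedMeasurable fun p => f p - g p := by
  obtain ⟨hfm, C, hC⟩ := hf
  obtain ⟨hgm, D, hD⟩ := hg
  exact ⟨hfm.sub hgm, C + D, fun p => (abs_sub _ _).trans (add_le_add (hC p) (hD p))⟩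

theorem BoundedMeasurable.section_div {q : X × A → ℝ} (hq : BoundedMeasurable q) (τ : ℝ) (x : X) :
    BoundedMeasurable fun a => q (x, a) / τ := by
  obtain ⟨hm, C, hC⟩ := hq
  refine ⟨(hm.comp measurable_prodMk_left).div_const τ, C / |τ|, fun a => ?_⟩
  rw [abs_div]
  gcongr
  exact hC _

theorem BoundedMeasurable.section_right {q : X × A → ℝ} (hq : BoundedMeasurable q) (x : X) :
    BoundedMeasurable fun a => q (x, a) := by
  simpa using hq.section_div 1 x

theorem BoundedMeasurable.exp {Ω : Type*} [MeasurableSpace Ω] {q : Ω → ℝ}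
    (hq : BoundedMeasurable q) : BoundedMeasurable fun p => Real.exp (q p) := by
  obtain ⟨hm, C, hC⟩ := hq
  refine ⟨hm.exp, Real.exp C, fun p => ?_⟩
  rw [Real.abs_exp]
  exact Real.exp_le_exp.mpr (le_of_abs_le (hC p))

theorem abs_integral_le_of_forall_abs_le {Ω : Type*} [MeasurableSpace Ω] {μ : Measure Ω}
    [IsProbabilityMeasure μ] {q : Ω → ℝ} {C : ℝ} (hC : ∀ p, |q p| ≤ C) :
    |∫ p, q p ∂μ| ≤ C := by
  simpa using norm_integral_le_of_norm_le_const (μ := μ) (f := q) (ae_of_all _ hC)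

theorem BoundedMeasurable.integral_kernel {q : X × A → ℝ} (hq : BoundedMeasurable q)
    (κ : Kernel X A) [IsMarkovKernel κ] : BoundedMeasurable fun x => ∫ a, q (x, a) ∂(κ x) := by
  obtain ⟨hm, C, hC⟩ := hq
  exact ⟨hm.stronglyMeasurable.integral_kernel_prod_right'.measurable, C,
    fun x => abs_integral_le_of_forall_abs_le fun a => hC (x, a)⟩

theorem BoundedMeasurable.softV {τ : ℝ} (hτ : 0 < τ) {piRef : Kernel X A} [IsMarkovKernel piRef]
    {q : X × A → ℝ} (hq : BoundedMeasurable q) : BoundedMeasurable (softV τ piRef q) := by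
  have hint := fun x => (hq.section_div τ x).exp.integrable (piRef x)
  obtain ⟨hm, C, hC⟩ := hq
  refine ⟨?_, C, fun x => ?_⟩
  · have := (hm.div_const τ).exp.stronglyMeasurable.integral_kernel_prod_right' (κ := piRef)
    exact this.measurable.log.const_mul τ
  · have hlow : Real.exp (-C / τ) ≤ ∫ a, Real.exp (q (x, a) / τ) ∂(piRef x) := by
      have := integral_mono (integrable_const _) (hint x) (fun a => Real.exp_le_exp.mpr
        (div_le_div_of_nonneg_right (abs_le.mp (hC (x, a))).1 hτ.le))
      simpa using this
    have hupp : ∫ a, Real.exp (q (x, a) / τ) ∂(piRef x) ≤ Real.exp (C / τ) := by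
      have := integral_mono (hint x) (integrable_const _) (fun a => Real.exp_le_exp.mpr
        (div_le_div_of_nonneg_right (abs_le.mp (hC (x, a))).2 hτ.le))
      simpa using this
    have hpos := (Real.exp_pos _).trans_le hlow
    have h1 := (Real.le_log_iff_exp_le hpos).mpr hlow
    have h2 := (Real.log_le_iff_le_exp hpos).mpr hupp
    rw [div_le_iff₀ hτ] at h1
    rw [le_div_iff₀ hτ] at h2
    rw [_root_.softV, abs_le]
    constructor <;> linarith

theorem integral_sub_KL_le_softV {τ : ℝ} (hτ : 0 < τ) {piRef : Kernel X A}
    [IsMarkovKernel piRef] {q : X × A → ℝ} (hq : BoundedMeasurable q) {x : X} {μ : Measure A}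
    [IsProbabilityMeasure μ] (hKL : KL μ (piRef x) ≠ ⊤) :
    ∫ a, q (x, a) ∂μ - τ * (KL μ (piRef x)).toReal ≤ softV τ piRef q x := by
  have h := integral_sub_KL_le_log_integral_exp ((hq.section_div τ x).integrable μ)
    ((hq.section_div τ x).exp.integrable (piRef x)) hKL
  rw [integral_div] at h
  calc ∫ a, q (x, a) ∂μ - τ * (KL μ (piRef x)).toReal
      = τ * ((∫ a, q (x, a) ∂μ) / τ - (KL μ (piRef x)).toReal) := by field_simp
    _ ≤ softV τ piRef q x := mul_le_mul_of_nonneg_left h hτ.le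

theorem withDensity_boltzmannGibbs_eq_tilted {τ : ℝ} (hτ : 0 < τ) {piRef : Kernel X A}
    [IsMarkovKernel piRef] {q : X × A → ℝ} (hq : BoundedMeasurable q) (x : X) :
    (piRef x).withDensity
      (fun a => ENNReal.ofReal (Real.exp ((q (x, a) - softV τ piRef q x) / τ)))
      = (piRef x).tilted fun a => q (x, a) / τ := by
  have hpos := integral_exp_pos ((hq.section_div τ x).exp.integrable (piRef x))
  rw [Measure.tilted]
  congr 1
  funext a
  rw [sub_div, softV, mul_div_cancel_left₀ _ hτ.ne', Real.exp_sub, Real.exp_log hpos]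

theorem integral_sub_KL_tilted_eq_softV {τ : ℝ} (hτ : 0 < τ) {piRef : Kernel X A}
    [IsMarkovKernel piRef] {q : X × A → ℝ} (hq : BoundedMeasurable q) {x : X} {μ : Measure A}
    [IsProbabilityMeasure μ] (hμ : μ = (piRef x).tilted fun a => q (x, a) / τ) :
    KL μ (piRef x) ≠ ⊤ ∧
      ∫ a, q (x, a) ∂μ - τ * (KL μ (piRef x)).toReal = softV τ piRef q x := by
  have hfμ := (hq.section_div τ x).integrable μ
  have hfν := (hq.section_div τ x).exp.integrable (piRef x)
  subst hμ
  refine ⟨KL_tilted_ne_top hfμ hfν, ?_⟩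
  have h := integral_sub_KL_tilted hfμ hfν
  rw [integral_div] at h
  rw [softV, ← h]
  field_simp

end BoundedMeasurable

section Bellman

variable {X A : Type*} [MeasurableSpace X] [MeasurableSpace A]
  {P : Kernel (X × A) X} [IsMarkovKernel P] {piRef : Kernel X A} [IsMarkovKernel piRef]
  {r : X × A → ℝ} {γ τ : ℝ} {qstar : X × A → ℝ}

/-- The fixed point of a policy-evaluation operator is dominated by that of the optimality
operator. -/
theorem softBellmanEval_fixedPoint_le [MeasurableSpace.CountableOrCountablyGenerated X A]
    (hγ0 : 0 ≤ γ) (hγ1 : γ < 1) (hτ : 0 < τ) (hqstar : BoundedMeasurable qstar)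
    (hqstarFix : softBellmanOpt τ γ r P piRef qstar = qstar)
    {pol : Kernel X A} [IsMarkovKernel pol]
    (hKL : ∀ p, ∫⁻ x', KL (pol x') (piRef x') ∂(P p) ≠ ⊤)
    {qpol : X × A → ℝ} (hqpol : BoundedMeasurable qpol)
    (hqpolFix : softBellmanEval τ γ r P piRef pol qpol = qpol) (p : X × A) :
    qpol p ≤ qstar p := by
  refine sub_nonpos.mp (nonpos_of_forall_le_imp_le_mul (f := fun p => qpol p - qstar p)
    hγ0 hγ1 ?_ ?_ p)
  · obtain ⟨_, C, hC⟩ := hqpol.sub hqstar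
    exact ⟨C, fun p => le_of_abs_le (hC p)⟩
  intro M hM p
  have hmeas := measurable_KL_kernel pol piRef
  have hV := hqstar.softV hτ (piRef := piRef)
  have hle : ∫ x', ((∫ a', qpol (x', a') ∂(pol x')) - τ * (KL (pol x') (piRef x')).toReal) ∂(P p)
      ≤ ∫ x', (softV τ piRef qstar x' + M) ∂(P p) := by
    refine integral_mono_ae (((hqpol.integral_kernel pol).integrable _).sub
      ((integrable_toReal_of_lintegral_ne_top hmeas.aemeasurable (hKL p)).const_mul τ))
      ((hV.integrable _).add (integrable_const M)) ?_
    filter_upwards [ae_lt_top hmeas (hKL p)] with x' hx'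
    have h1 := integral_sub_KL_le_softV hτ hqstar hx'.ne
    have h2 : ∫ a', qpol (x', a') ∂(pol x') ≤ ∫ a', (qstar (x', a') + M) ∂(pol x') :=
      integral_mono ((hqpol.section_right x').integrable _)
        (((hqstar.section_right x').integrable _).add (integrable_const M))
        fun a' => by linarith [hM (x', a')]
    rw [integral_add ((hqstar.section_right x').integrable _) (integrable_const M)] at h2
    simp only [integral_const, probReal_univ, one_smul] at h2
    linarith
  rw [integral_add (hV.integrable _) (integrable_const M)] at hle
  simp only [integral_const, probReal_univ, one_smul] at hle
  have e1 := congrFun hqpolFix p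
  have e2 := congrFun hqstarFix p
  simp only [softBellmanEval] at e1
  simp only [softBellmanOpt] at e2
  have := mul_le_mul_of_nonneg_left hle hγ0
  linarith

/-- The evaluation operator of the Boltzmann–Gibbs policy of `qstar` has the same fixed point as
the optimality operator. -/
theorem softBellmanEval_boltzmannGibbs_fixedPoint_eq
    (hγ0 : 0 ≤ γ) (hγ1 : γ < 1) (hτ : 0 < τ) (hqstar : BoundedMeasurable qstar)
    (hqstarFix : softBellmanOpt τ γ r P piRef qstar = qstar)
    {pol : Kernel X A} [IsMarkovKernel pol]
    (hpol : ∀ x, pol x = (piRef x).tilted fun a => qstar (x, a) / τ)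
    {qpol : X × A → ℝ} (hqpol : BoundedMeasurable qpol)
    (hqpolFix : softBellmanEval τ γ r P piRef pol qpol = qpol) :
    qpol = qstar := by
  have hD := hqpol.sub hqstar
  have hV := hqstar.softV hτ (piRef := piRef)
  funext p
  refine sub_eq_zero.mp (abs_nonpos_iff.mp (nonpos_of_forall_le_imp_le_mul
    (f := fun p => |qpol p - qstar p|) hγ0 hγ1 hD.2 ?_ p))
  intro M hM p
  have hint : ∀ x', (∫ a', qpol (x', a') ∂(pol x')) - τ * (KL (pol x') (piRef x')).toReal
      = ∫ a', (qpol (x', a') - qstar (x', a')) ∂(pol x') + softV τ piRef qstar x' := by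
    intro x'
    rw [integral_sub ((hqpol.section_right x').integrable _)
      ((hqstar.section_right x').integrable _),
      ← (integral_sub_KL_tilted_eq_softV hτ hqstar (hpol x')).2]
    ring
  have e1 := congrFun hqpolFix p
  have e2 := congrFun hqstarFix p
  simp only [softBellmanEval, hint] at e1
  simp only [softBellmanOpt] at e2
  rw [integral_add ((hD.integral_kernel pol).integrable _) (hV.integrable _)] at e1
  have e3 : qpol p - qstar p
      = γ * ∫ x', ∫ a', (qpol (x', a') - qstar (x', a')) ∂(pol x') ∂(P p) := by
    linarith
  rw [e3, abs_mul, abs_of_nonneg hγ0]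
  refine mul_le_mul_of_nonneg_left (abs_integral_le_of_forall_abs_le fun x' => ?_) hγ0
  exact abs_integral_le_of_forall_abs_le fun a' => hM (x', a')

end Bellman

theorem EReal.coe_sub_mul_coe_ennreal_of_ne_top (a τ : ℝ) {k : ℝ≥0∞} (hk : k ≠ ⊤) :
    (a : EReal) - (τ : EReal) * (k : EReal) = ((a - τ * k.toReal : ℝ) : EReal) := by
  lift k to NNReal using hk
  rw [EReal.coe_sub, EReal.coe_mul]
  rfl

/-- The regularized value of every admissible policy is dominated by the soft optimal value
`V_τ q*_τ`, with equality for the Boltzmann–Gibbs policy of `q*_τ`; hence the Boltzmann–Gibbs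
policy of `q*_τ` is the optimal policy of the `τ`-entropy-regularized problem. -/
theorem boltzmannGibbs_policy_is_optimal
    {X A : Type*} [MeasurableSpace X] [MeasurableSpace A]
    [StandardBorelSpace X] [StandardBorelSpace A]
    (P : Kernel (X × A) X) [IsMarkovKernel P]
    (piRef : Kernel X A) [IsMarkovKernel piRef]
    (r : X × A → ℝ) (hr : BoundedMeasurable r)
    (γ : ℝ) (hγ0 : 0 < γ) (hγ1 : γ < 1)
    (τ : ℝ) (hτ : 0 < τ)
    (qstar : X × A → ℝ) (hqstar : BoundedMeasurable qstar)
    (hqstarFix : softBellmanOpt τ γ r P piRef qstar = qstar)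
    (polStar : Kernel X A) [IsMarkovKernel polStar]
    (hpolStar : ∀ x : X, polStar x = (piRef x).withDensity
      (fun a => ENNReal.ofReal (Real.exp ((qstar (x, a) - softV τ piRef qstar x) / τ))))
    (qpolStar : X × A → ℝ) (hqpolStar : BoundedMeasurable qpolStar)
    (hqpolStarFix : softBellmanEval τ γ r P piRef polStar qpolStar = qpolStar) :
    (∀ (pol : Kernel X A), IsMarkovKernel pol →
      (∃ C : ℝ≥0∞, C ≠ ⊤ ∧ ∀ p : X × A, ∫⁻ x', KL (pol x') (piRef x') ∂(P p) ≤ C) →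
      ∀ (qpol : X × A → ℝ), BoundedMeasurable qpol →
        softBellmanEval τ γ r P piRef pol qpol = qpol →
        ∀ x : X,
          ((∫ a, qpol (x, a) ∂(pol x) : ℝ) : EReal) - (τ : EReal) * (KL (pol x) (piRef x) : EReal)
            ≤ ((softV τ piRef qstar x : ℝ) : EReal)) ∧
    (∀ x : X,
      ((∫ a, qpolStar (x, a) ∂(polStar x) : ℝ) : EReal)
          - (τ : EReal) * (KL (polStar x) (piRef x) : EReal)
        = ((softV τ piRef qstar x : ℝ) : EReal)) := by
  have hpolStar' : ∀ x, polStar x = (piRef x).tilted fun a => qstar (x, a) / τ := fun x =>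
    (hpolStar x).trans (withDensity_boltzmannGibbs_eq_tilted hτ hqstar x)
  refine ⟨fun pol _ ⟨C, hC, hKL⟩ qpol hqpol hqpolFix x => ?_, fun x => ?_⟩
  · by_cases hx : KL (pol x) (piRef x) = ⊤
    · simp [hx, EReal.coe_mul_top_of_pos hτ]
    · rw [EReal.coe_sub_mul_coe_ennreal_of_ne_top _ _ hx, EReal.coe_le_coe_iff]
      have hle := softBellmanEval_fixedPoint_le hγ0.le hγ1 hτ hqstar hqstarFix
        (fun p => ne_top_of_le_ne_top hC (hKL p)) hqpol hqpolFix
      have hint := integral_mono ((hqpol.section_right x).integrable (pol x))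
        ((hqstar.section_right x).integrable (pol x)) fun a => hle (x, a)
      linarith [integral_sub_KL_le_softV hτ hqstar hx]
  · obtain ⟨hx, heq⟩ := integral_sub_KL_tilted_eq_softV hτ hqstar (hpolStar' x)
    rw [EReal.coe_sub_mul_coe_ennreal_of_ne_top _ _ hx,
      softBellmanEval_boltzmannGibbs_fixedPoint_eq hγ0.le hγ1 hτ hqstar hqstarFix hpolStar'
        hqpolStar hqpolStarFix, heq]
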